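/- arXiv:2107.08353 — 5 statements merged into one kernel-verified Lean document; each statement's English description precedes it below -/
import Mathlib

section
/- The confidence maximum-calibration-error is at most the top-label maximum-calibration-error: essSup |E[1{Y=C} | σ(H)] − H| ≤ essSup |E[1{Y=C} | σ(C,H)] − H|, where essSup denotes the essential supremum with respect to P. -/
open MeasureTheory

/-- Almost everywhere upper bounds on `|μ[f | m₂] - h|` carry over to `|μ[f | m₁] - h|` when
`m₁ ≤ m₂` and `h` is `m₁`-measurable. -/
lemma ae_abs_condExp_sub_le_of_le {Ω : Type*} {m₁ m₂ m₀ : MeasurableSpace Ω} {μ : Measure Ω}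
    [IsFiniteMeasure μ] (h₁₂ : m₁ ≤ m₂) (h₂ : m₂ ≤ m₀) {f h : Ω → ℝ}
    (hm : StronglyMeasurable[m₁] h) (hint : Integrable h μ) {a : ℝ}
    (hbd : ∀ᵐ ω ∂μ, |(μ[f | m₂]) ω - h ω| ≤ a) :
    ∀ᵐ ω ∂μ, |(μ[f | m₁]) ω - h ω| ≤ a := by
  have hsub : μ[μ[f | m₂] - h | m₁] =ᵐ[μ] μ[μ[f | m₂] | m₁] - μ[h | m₁] :=
    condExp_sub integrable_condExp hint m₁
  have htower : μ[μ[f | m₂] | m₁] =ᵐ[μ] μ[f | m₁] := condExp_condExp_of_le h₁₂ h₂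
  have hself : μ[h | m₁] = h := condExp_of_stronglyMeasurable (h₁₂.trans h₂) hm hint
  have hcond : ∀ᵐ ω ∂μ, |(μ[μ[f | m₂] - h | m₁]) ω| ≤ a := ae_bdd_abs_condExp_of_ae_bdd_abs hbd
  filter_upwards [hsub, htower, hcond] with ω hω₁ hω₂ hω₃
  rwa [hω₁, Pi.sub_apply, hω₂, hself] at hω₃

/-- The essential supremum of `|μ[f | m] - h|` is monotone in `m`, for `f` bounded and `h`
measurable with respect to the smaller σ-algebra. If `h` is essentially unbounded, both sides are
the infimum of the empty set. -/
lemma essSup_abs_condExp_sub_le_of_le {Ω : Type*} {m₁ m₂ m₀ : MeasurableSpace Ω} {μ : Measure Ω}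
    [IsFiniteMeasure μ] [NeZero μ] (h₁₂ : m₁ ≤ m₂) (h₂ : m₂ ≤ m₀) {f h : Ω → ℝ}
    (hm : StronglyMeasurable[m₁] h) (hint : Integrable h μ) {R : ℝ}
    (hf : ∀ᵐ ω ∂μ, |f ω| ≤ R) :
    essSup (fun ω => |(μ[f | m₁]) ω - h ω|) μ ≤ essSup (fun ω => |(μ[f | m₂]) ω - h ω|) μ := by
  have nonneg_of_bound : ∀ a : ℝ,
      (∀ᵐ ω ∂μ, |(μ[f | m₁]) ω - h ω| ≤ a) → 0 ≤ a := fun a ha => by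
    obtain ⟨ω, hω⟩ := ha.exists
    exact (abs_nonneg _).trans hω
  simp only [essSup, Filter.limsup_eq]
  by_cases hne : {a : ℝ | ∀ᵐ ω ∂μ, |(μ[f | m₂]) ω - h ω| ≤ a}.Nonempty
  · exact csInf_le_csInf ⟨0, nonneg_of_bound⟩ hne fun a ha =>
      ae_abs_condExp_sub_le_of_le h₁₂ h₂ hm hint ha
  · have hempty : {a : ℝ | ∀ᵐ ω ∂μ, |(μ[f | m₁]) ω - h ω| ≤ a} = ∅ := by
      refine Set.eq_empty_of_forall_notMem fun a ha => hne ⟨a + R + R, ?_⟩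
      have hc₁ : ∀ᵐ ω ∂μ, |(μ[f | m₁]) ω| ≤ R := ae_bdd_abs_condExp_of_ae_bdd_abs hf
      have hc₂ : ∀ᵐ ω ∂μ, |(μ[f | m₂]) ω| ≤ R := ae_bdd_abs_condExp_of_ae_bdd_abs hf
      filter_upwards [ha, hc₁, hc₂] with ω hω hω₁ hω₂
      rw [abs_le] at *
      constructor <;> linarith
    rw [hempty, Set.not_nonempty_iff_eq_empty.mp hne]

/-- conf-MCE(C,H) ≤ TL-MCE(C,H), where MCE is the essential supremum
    of the absolute calibration deviation. -/
theorem conf_MCE_le_TL_MCE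
    {Ω : Type*} [MeasurableSpace Ω] (P : Measure Ω) [IsProbabilityMeasure P]
    (L : ℕ) (hL : 2 ≤ L)
    (Y C : Ω → Fin L) (H : Ω → ℝ)
    (hY : Measurable Y) (hC : Measurable C) (hH : Measurable H)
    (hHint : Integrable H P) :
    essSup (fun ω => |(P[(fun ω => if Y ω = C ω then (1 : ℝ) else 0) |
        MeasurableSpace.comap H inferInstance]) ω - H ω|) P
      ≤ essSup (fun ω => |(P[(fun ω => if Y ω = C ω then (1 : ℝ) else 0) |
        MeasurableSpace.comap (fun ω => (C ω, H ω)) inferInstance]) ω - H ω|) P := by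
  refine essSup_abs_condExp_sub_le_of_le (R := 1) ?_ (hC.prodMk hH).comap_le
    (comap_measurable H).stronglyMeasurable hHint (Filter.Eventually.of_forall fun ω => ?_)
  · exact (measurable_snd.comp (comap_measurable fun ω => (C ω, H ω))).comap_le
  · split_ifs <;> simp
end

section
/- There exist a probability space (Ω, 𝒜, P) and measurable random variables Y : Ω → Fin 2, C : Ω → Fin 2 and the constant confidence H ≡ 3/5, such that the predictor is perfectly confidence calibrated (E[1{Y=C} | σ(H)] = 3/5 holds P-almost everywhere, so conf-ECE(C,H) = 0), while its top-label calibration error satisfies TL-ECE(C,H) = E[ |E[1{Y=C} | σ(C,H)] − H| ] = 2/5. Concretely this is witnessed by P(C = 0) = P(C = 1) = 1/2, P(Y = C | C = 0) = 1/5 and P(Y = C | C = 1) = 1. -/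
open MeasureTheory
open scoped ENNReal

namespace TopLabelCalibration

/-- The law on three points with masses `1/10`, `2/5`, `1/2`. -/
noncomputable def law : Measure (Fin 3) :=
  (1 / 10 : ℝ≥0∞) • Measure.dirac 0 + (2 / 5 : ℝ≥0∞) • Measure.dirac 1 +
    (1 / 2 : ℝ≥0∞) • Measure.dirac 2

/-- The true label. -/
def trueLabel : Fin 3 → Fin 2 := ![0, 1, 1]

/-- The predicted top label. -/
def topLabel : Fin 3 → Fin 2 := ![0, 0, 1]

@[simp] theorem trueLabel_zero : trueLabel 0 = 0 := rfl
@[simp] theorem trueLabel_one : trueLabel 1 = 1 := rfl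
@[simp] theorem trueLabel_two : trueLabel 2 = 1 := rfl
@[simp] theorem topLabel_zero : topLabel 0 = 0 := rfl
@[simp] theorem topLabel_one : topLabel 1 = 0 := rfl
@[simp] theorem topLabel_two : topLabel 2 = 1 := rfl

theorem law_apply (s : Set (Fin 3)) :
    law s = 1 / 10 * s.indicator 1 0 + 2 / 5 * s.indicator 1 1 + 1 / 2 * s.indicator 1 2 := by
  simp [law]

theorem ennreal_weights_add : (1 / 10 : ℝ≥0∞) + 2 / 5 = 1 / 2 := by
  rw [← ENNReal.toReal_eq_toReal_iff' (by finiteness) (by finiteness),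
    ENNReal.toReal_add (by finiteness) (by finiteness)]
  norm_num [ENNReal.toReal_div]

instance : IsProbabilityMeasure law := by
  constructor
  simp [law_apply, -one_div, ennreal_weights_add, ENNReal.add_halves]

theorem integral_law (f : Fin 3 → ℝ) :
    ∫ ω, f ω ∂law = 1 / 10 * f 0 + 2 / 5 * f 1 + 1 / 2 * f 2 := by
  rw [integral_fintype Integrable.of_finite]
  simp [Fin.sum_univ_three, law_apply, measureReal_def]

theorem law_topLabel_zero : law {ω | topLabel ω = 0} = 1 / 2 := by
  simp [law_apply, Set.indicator_apply, -one_div, ennreal_weights_add]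

theorem law_topLabel_one : law {ω | topLabel ω = 1} = 1 / 2 := by
  simp [law_apply, Set.indicator_apply]

theorem condExp_correct_const (c : ℝ) :
    law[(fun ω => if trueLabel ω = topLabel ω then (1 : ℝ) else 0) |
      MeasurableSpace.comap (fun _ : Fin 3 => c) inferInstance] = fun _ => 3 / 5 := by
  rw [MeasurableSpace.comap_const, condExp_bot, integral_law]
  norm_num

theorem condExp_correct_topLabel (c : ℝ) :
    law[(fun ω => if trueLabel ω = topLabel ω then (1 : ℝ) else 0) |
      MeasurableSpace.comap (fun ω => (topLabel ω, c)) inferInstance] =ᵐ[law]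
      fun ω => if topLabel ω = 0 then 1 / 5 else 1 := by
  have hm : MeasurableSpace.comap (fun ω => (topLabel ω, c)) inferInstance ≤
      (inferInstance : MeasurableSpace (Fin 3)) :=
    (measurable_of_finite _).comap_le
  symm
  refine ae_eq_condExp_of_forall_setIntegral_eq hm Integrable.of_finite
    (fun _ _ _ => Integrable.of_finite) ?_ ?_
  · rintro s ⟨t, ht, rfl⟩ -
    have hs : MeasurableSet ((fun ω => (topLabel ω, c)) ⁻¹' t) := hm _ ⟨t, ht, rfl⟩
    rw [← integral_indicator hs, ← integral_indicator hs, integral_law, integral_law]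
    by_cases h₀ : ((0 : Fin 2), c) ∈ t <;> by_cases h₁ : ((1 : Fin 2), c) ∈ t <;>
      norm_num [h₀, h₁]
  · have hg : Measurable fun p : Fin 2 × ℝ => if p.1 = 0 then (1 / 5 : ℝ) else 1 :=
      (measurable_of_finite fun i : Fin 2 => if i = 0 then (1 / 5 : ℝ) else 1).comp measurable_fst
    exact (hg.comp (comap_measurable fun ω =>
      (topLabel ω, c))).stronglyMeasurable.aestronglyMeasurable

end TopLabelCalibration

open TopLabelCalibration

/-- there is a predictor with constant confidence H ≡ 3/5 that is perfectly
    confidence calibrated (conf-ECE = 0) but has TL-ECE = 2/5, witnessed by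
    P(C=0) = P(C=1) = 1/2, P(Y=C | C=0) = 1/5 and P(Y=C | C=1) = 1. -/
theorem exists_conf_calibrated_not_top_label_calibrated :
    ∃ (Ω : Type) (_ : MeasurableSpace Ω) (P : Measure Ω),
      IsProbabilityMeasure P ∧
      ∃ Y C : Ω → Fin 2, Measurable Y ∧ Measurable C ∧
        (∀ᵐ ω ∂P, (P[(fun ω => if Y ω = C ω then (1 : ℝ) else 0) |
            MeasurableSpace.comap (fun _ : Ω => (3 / 5 : ℝ)) inferInstance]) ω = 3 / 5) ∧
        (∫ ω, |(P[(fun ω => if Y ω = C ω then (1 : ℝ) else 0) |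
            MeasurableSpace.comap (fun _ : Ω => (3 / 5 : ℝ)) inferInstance]) ω - 3 / 5| ∂P = 0) ∧
        (∫ ω, |(P[(fun ω => if Y ω = C ω then (1 : ℝ) else 0) |
            MeasurableSpace.comap (fun ω => (C ω, (3 / 5 : ℝ))) inferInstance]) ω - 3 / 5| ∂P
          = 2 / 5) ∧
        P {ω | C ω = 0} = 1 / 2 ∧ P {ω | C ω = 1} = 1 / 2 ∧
        P ({ω | Y ω = C ω} ∩ {ω | C ω = 0}) / P {ω | C ω = 0} = 1 / 5 ∧
        P ({ω | Y ω = C ω} ∩ {ω | C ω = 1}) / P {ω | C ω = 1} = 1 := by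
  refine ⟨Fin 3, inferInstance, law, inferInstance, trueLabel, topLabel, measurable_of_finite _,
    measurable_of_finite _, ?_, ?_, ?_, law_topLabel_zero, law_topLabel_one, ?_, ?_⟩
  · rw [condExp_correct_const]
    simp
  · rw [condExp_correct_const]
    simp
  · have h := condExp_correct_topLabel (3 / 5)
    rw [integral_congr_ae (h.mono fun ω hω => by rw [hω]), integral_law]
    norm_num [abs_of_neg, abs_of_pos]
  · have hc : law ({ω | trueLabel ω = topLabel ω} ∩ {ω | topLabel ω = 0}) = 1 / 10 := by
      simp [law_apply]
    rw [hc, law_topLabel_zero, ← ENNReal.toReal_eq_toReal_iff'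
      (ENNReal.div_ne_top (by finiteness) (by simp)) (by finiteness)]
    norm_num [ENNReal.toReal_div]
  · rw [law_topLabel_one, law_apply]
    simp [ENNReal.div_self]
end

section
/- Gluing lemma for top-label conditional expectations: define the merged confidence H(ω) := H_{C(ω)}(ω). Then for every label l ∈ Fin L with P(C = l) > 0, the conditional expectation E_P[1{Y=C} | σ(C,H)] agrees P-almost everywhere on the event {C = l} with (a version of) the conditional expectation E_{P_l}[1{Y=l} | σ(H_l)] computed under the conditional probability measure P_l := P(· ∩ {C=l})/P(C=l). -/
open MeasureTheory

open ProbabilityTheory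

/-- If, on an event `Z ⁻¹' B`, the variables `Z` and `W` are measurable functions of each other, then
on that event conditioning on `Z` agrees with conditioning on `W` under the conditional measure. -/
theorem condExp_comap_ae_eq_condExp_cond {Ω E F : Type*} {mΩ : MeasurableSpace Ω}
    [mE : MeasurableSpace E] [mF : MeasurableSpace F] {P : Measure Ω} [IsFiniteMeasure P]
    {Z : Ω → E} {W : Ω → F} (hZ : Measurable Z) (hW : Measurable W)
    {B : Set E} (hB : MeasurableSet B) {i : F → E} {j : E → F}
    (hi : Measurable i) (hj : Measurable j)
    (hZW : ∀ ω, Z ω ∈ B → Z ω = i (W ω)) (hWZ : ∀ ω, Z ω ∈ B → W ω = j (Z ω))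
    {f : Ω → ℝ} (hf : Integrable f P) :
    P[f | mE.comap Z] =ᵐ[cond P (Z ⁻¹' B)] (cond P (Z ⁻¹' B))[f | mF.comap W] := by
  have hs : MeasurableSet (Z ⁻¹' B) := hZ hB
  have integrable_cond {g : Ω → ℝ} (hg : Integrable g P) : Integrable g (cond P (Z ⁻¹' B)) := by
    by_cases h0 : P (Z ⁻¹' B) = 0
    · simp [cond_eq_zero_of_meas_eq_zero h0]
    · exact hg.restrict.smul_measure (ENNReal.inv_ne_top.2 h0)
  refine ae_eq_condExp_of_forall_setIntegral_eq hW.comap_le (integrable_cond hf)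
    (fun _ _ _ => (integrable_cond integrable_condExp).integrableOn) ?_ ?_
  · rintro _ ⟨u, hu, rfl⟩ -
    have key : W ⁻¹' u ∩ Z ⁻¹' B = Z ⁻¹' (j ⁻¹' u ∩ B) := by
      ext ω
      simp only [Set.mem_inter_iff, Set.mem_preimage]
      exact and_congr_left fun h => by rw [hWZ ω h]
    simp only [ProbabilityTheory.cond, Measure.restrict_smul, integral_smul_measure,
      Measure.restrict_restrict (hW hu), key]
    rw [setIntegral_condExp hZ.comap_le hf ⟨_, (hj hu).inter hB, rfl⟩]
  · have hm : Measurable[mE.comap Z] (P[f | mE.comap Z]) := stronglyMeasurable_condExp.measurable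
    obtain ⟨φ, hφ, hφ_eq⟩ := hm.exists_eq_measurable_comp
    refine ⟨fun ω => φ (i (W ω)),
      ((hφ.comp hi).comp (comap_measurable W)).stronglyMeasurable, ?_⟩
    filter_upwards [ae_cond_mem hs] with ω hω
    rw [hφ_eq, Function.comp_apply, hZW ω hω]

/-- gluing lemma for top-label conditional expectations. With the merged
    confidence H(ω) := H_{C(ω)}(ω), for every label l with P(C = l) > 0, the conditional
    expectation E_P[1{Y=C} | σ(C,H)] agrees, almost everywhere under the conditional
    measure P_l = P(· | C = l), with the conditional expectation
    E_{P_l}[1{Y=l} | σ(H_l)]. -/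
theorem top_label_condexp_glue
    {Ω : Type*} [MeasurableSpace Ω] (P : Measure Ω) [IsProbabilityMeasure P]
    (L : ℕ) (hL : 2 ≤ L)
    (Y C : Ω → Fin L) (hY : Measurable Y) (hC : Measurable C)
    (H : Fin L → Ω → ℝ) (hH : ∀ l, Measurable (H l)) (hHint : ∀ l, Integrable (H l) P)
    (l : Fin L) (hl : P {ω | C ω = l} ≠ 0) :
    ∀ᵐ ω ∂(ProbabilityTheory.cond P {ω | C ω = l}),
      (P[(fun ω => if Y ω = C ω then (1 : ℝ) else 0) |
          MeasurableSpace.comap (fun ω => (C ω, H (C ω) ω)) inferInstance]) ω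
        = ((ProbabilityTheory.cond P {ω | C ω = l})[(fun ω => if Y ω = l then (1 : ℝ) else 0) |
            MeasurableSpace.comap (H l) inferInstance]) ω := by
  have hHC : Measurable fun ω => H (C ω) ω :=
    (measurable_from_prod_countable_right (f := fun p : Fin L × Ω => H p.1 p.2) hH).comp
      (hC.prodMk measurable_id)
  have hf : Integrable (fun ω => if Y ω = C ω then (1 : ℝ) else 0) P :=
    ((integrable_const (1 : ℝ)).indicator (measurableSet_eq_fun hY hC)).congr
      (.of_forall fun ω => by simp [Set.indicator_apply])
  have hs : MeasurableSet {ω | C ω = l} := hC (measurableSet_singleton l)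
  have glue := condExp_comap_ae_eq_condExp_cond (P := P) (hC.prodMk hHC) (hH l)
    (measurable_fst (measurableSet_singleton l)) (i := fun x => (l, x)) measurable_prodMk_left
    measurable_snd (by rintro ω rfl; rfl) (by rintro ω rfl; rfl) hf
  refine glue.trans (condExp_congr_ae ?_)
  filter_upwards [ae_cond_mem hs] with ω (hω : C ω = l)
  rw [hω]
end

section
/- The grid-style bins mutually exhaust the probability simplex: for every natural L ≥ 3, every natural K ≥ 1, and every s : Fin L → ℝ with s_l ≥ 0 for all l and Σ_l s_l = 1, there exists a tuple k : Fin L → ℕ with k_l ≥ 1 for all l, max(L, K+1) ≤ Σ_l k_l ≤ K + L − 1, and (k_l − 1 : ℝ) ≤ s_l · K ≤ (k_l : ℝ) for every l ∈ Fin L. -/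
/-- the grid-style bins mutually exhaust the probability simplex. -/
theorem grid_bins_exhaust_simplex
    (L K : ℕ) (hL : 3 ≤ L) (hK : 1 ≤ K)
    (s : Fin L → ℝ) (hs0 : ∀ l, 0 ≤ s l) (hs1 : ∑ l, s l = 1) :
    ∃ k : Fin L → ℕ,
      (∀ l, 1 ≤ k l) ∧
      max L (K + 1) ≤ ∑ l, k l ∧
      ∑ l, k l ≤ K + L - 1 ∧
      ∀ l, ((k l : ℝ) - 1 ≤ s l * K ∧ s l * K ≤ (k l : ℝ)) := by
  have hx0 : ∀ l, 0 ≤ s l * K := fun l => mul_nonneg (hs0 l) K.cast_nonneg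
  have hxsum : ∑ l, s l * (K : ℝ) = K := by rw [← Finset.sum_mul, hs1, one_mul]
  have hfle : ∀ l, (⌊s l * K⌋₊ : ℝ) ≤ s l * K := fun l => Nat.floor_le (hx0 l)
  have hflt : ∀ l, s l * K < (⌊s l * K⌋₊ : ℝ) + 1 := fun l => Nat.lt_floor_add_one _
  have hle : ∑ l, ⌊s l * K⌋₊ ≤ K := by
    have h := Finset.sum_le_sum fun l (_ : l ∈ Finset.univ) => hfle l
    rw [hxsum] at h
    exact_mod_cast h
  rcases hle.lt_or_eq with hlt | heq
  · have hsum : ∑ l, (⌊s l * K⌋₊ + 1) = ∑ l, ⌊s l * K⌋₊ + L := by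
      simp [Finset.sum_add_distrib]
    have hgt : K < ∑ l, (⌊s l * K⌋₊ + 1) := by
      have h : ∑ l, s l * (K : ℝ) < ∑ l, ((⌊s l * K⌋₊ : ℝ) + 1) :=
        Finset.sum_lt_sum_of_nonempty ⟨⟨0, by omega⟩, Finset.mem_univ _⟩ fun l _ => hflt l
      rw [hxsum] at h
      exact_mod_cast h
    refine ⟨fun l => ⌊s l * K⌋₊ + 1, fun l => by simp, max_le ?_ hgt, ?_, fun l => ?_⟩
    · dsimp only
      omega
    · dsimp only
      omega
    · push_cast
      exact ⟨by linarith [hfle l], (hflt l).le⟩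
  · -- every coordinate is an integer, so one positive coordinate is rounded to itself
    have hint : ∀ l, (⌊s l * K⌋₊ : ℝ) = s l * K := by
      have h : ∑ l, (⌊s l * K⌋₊ : ℝ) = ∑ l, s l * (K : ℝ) := by
        rw [hxsum]
        exact_mod_cast heq
      simpa using (Finset.sum_eq_sum_iff_of_le fun l _ => hfle l).1 h
    obtain ⟨j, -, hj⟩ : ∃ j ∈ Finset.univ, ⌊s j * K⌋₊ ≠ 0 :=
      Finset.exists_ne_zero_of_sum_ne_zero (by omega)
    have hsum : ∑ l, (⌊s l * K⌋₊ + if l = j then 0 else 1) + 1 = K + L := by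
      have h : ∑ l : Fin L, (if l = j then 0 else 1) + ∑ l : Fin L, (if l = j then 1 else 0)
          = L := by
        rw [← Finset.sum_add_distrib, Finset.sum_congr rfl (g := fun _ => 1)]
        · simp
        · intro l _
          split_ifs <;> rfl
      rw [Finset.sum_ite_eq' Finset.univ j, if_pos (Finset.mem_univ j)] at h
      rw [Finset.sum_add_distrib, heq, add_assoc, h]
    refine ⟨fun l => ⌊s l * K⌋₊ + if l = j then 0 else 1, fun l => ?_, max_le ?_ ?_, ?_,
      fun l => ?_⟩
    · dsimp only
      split_ifs with h
      · subst h
        omega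
      · omega
    · dsimp only
      omega
    · dsimp only
      omega
    · dsimp only
      omega
    · have h := hint l
      dsimp only
      split_ifs <;> push_cast <;> constructor <;> linarith
end

section
/- Every grid-style bin contains a scaled and translated copy of the simplex: for naturals L ≥ 3, K ≥ 1 and any tuple k : Fin L → ℕ with k_l ≥ 1 for all l and max(L, K+1) ≤ Σ_l k_l ≤ K + L − 1, there exist u : Fin L → ℝ and v > 0 such that for every t : Fin L → ℝ with t_l ≥ 0 for all l and Σ_l t_l = 1, the point s := u + v·t satisfies s_l ≥ 0 for all l, Σ_l s_l = 1, and (k_l − 1 : ℝ) ≤ s_l · K ≤ (k_l : ℝ) for all l; in particular each bin b_k has nonzero (L−1)-dimensional volume. -/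
/-- every grid-style bin contains a scaled and translated copy of the
    probability simplex. -/
theorem grid_bin_contains_scaled_simplex
    (L K : ℕ) (hL : 3 ≤ L) (hK : 1 ≤ K)
    (k : Fin L → ℕ) (hk1 : ∀ l, 1 ≤ k l)
    (hklo : max L (K + 1) ≤ ∑ l, k l) (hkhi : ∑ l, k l ≤ K + L - 1) :
    ∃ (u : Fin L → ℝ) (v : ℝ), 0 < v ∧
      ∀ t : Fin L → ℝ, (∀ l, 0 ≤ t l) → ∑ l, t l = 1 →
        (∀ l, 0 ≤ u l + v * t l) ∧
        (∑ l, (u l + v * t l)) = 1 ∧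
        ∀ l, ((k l : ℝ) - 1 ≤ (u l + v * t l) * K ∧ (u l + v * t l) * K ≤ (k l : ℝ)) := by
  have hL0 : (0 : ℝ) < L := by exact_mod_cast (by omega : 0 < L)
  have hK0 : (0 : ℝ) < K := by exact_mod_cast hK
  have hlo : (K : ℝ) + 1 ≤ ∑ l, (k l : ℝ) := by
    exact_mod_cast (le_max_right _ _).trans hklo
  have hhi : ∑ l, (k l : ℝ) + 1 ≤ K + L := by
    exact_mod_cast (by omega : ∑ l, k l + 1 ≤ K + L)
  obtain ⟨w, hw⟩ : ∃ w : ℝ, w = 1 / L := ⟨_, rfl⟩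
  have hw0 : 0 < w := by rw [hw]; positivity
  have hLw : (L : ℝ) * w = 1 := by rw [hw]; field_simp
  have hw1 : w ≤ 1 := by
    rw [hw, div_le_one hL0]
    exact_mod_cast (by omega : 1 ≤ L)
  -- In coordinates scaled by `K`, the copy has edge scale `w` and corner `k - 1 + a`.
  obtain ⟨a, ha⟩ : ∃ a : ℝ, a = (K + L - ∑ l, (k l : ℝ) - w) / L := ⟨_, rfl⟩
  have hLa : (L : ℝ) * a = K + L - ∑ l, (k l : ℝ) - w := by rw [ha]; field_simp
  have ha0 : 0 ≤ a := by
    rw [ha]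
    exact div_nonneg (by linarith) hL0.le
  have haw : a + w ≤ 1 := by
    refine le_of_mul_le_mul_left ?_ hL0
    linarith
  refine ⟨fun l => (k l - 1 + a) / K, w / K, by positivity, fun t ht hsum => ?_⟩
  have hscale (l : Fin L) : (k l - 1 + a) / K + w / K * t l = (k l - 1 + a + w * t l) / K := by
    ring
  have hk (l : Fin L) : (1 : ℝ) ≤ k l := by exact_mod_cast hk1 l
  have hwt0 (l : Fin L) : 0 ≤ w * t l := mul_nonneg hw0.le (ht l)
  have hwt1 (l : Fin L) : w * t l ≤ w := by
    refine mul_le_of_le_one_right hw0.le ?_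
    rw [← hsum]
    exact Finset.single_le_sum (fun i _ => ht i) (Finset.mem_univ l)
  simp only [hscale]
  refine ⟨fun l => div_nonneg (by linarith [hk l, hwt0 l]) hK0.le, ?_, fun l => ?_⟩
  · rw [← Finset.sum_div, div_eq_one_iff_eq hK0.ne']
    simp only [Finset.sum_add_distrib, Finset.sum_sub_distrib, ← Finset.mul_sum, hsum,
      Finset.sum_const, Finset.card_univ, Fintype.card_fin, nsmul_eq_mul]
    linarith
  · rw [div_mul_cancel₀ _ hK0.ne']
    constructor <;> linarith [hwt0 l, hwt1 l]
end
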